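/- In Version C, a position with exactly three piles is a P-position if and only if either all three pile sizes are even or all three pile sizes are odd. -/

import Mathlib

/-- Remove one token from a pile of size `p` in `G`: delete one copy of `p` and,
if `p ≠ 1`, add back a pile of size `p - 1`. -/
def takeOne (G : Multiset ℕ) (p : ℕ) : Multiset ℕ :=
  G.erase p + (if p = 1 then (0 : Multiset ℕ) else {p - 1})

/-- Legal moves of Version C: remove one token from one chosen pile, or choose two
piles (counted with multiplicity) and remove one token from each of them
(piles reaching size 0 are deleted). -/
inductive MoveC : Multiset ℕ → Multiset ℕ → Prop
  | one {G : Multiset ℕ} {p : ℕ} (hp : p ∈ G) (h1 : 1 ≤ p) : MoveC G (takeOne G p)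
  | two {G : Multiset ℕ} {p q : ℕ} (hp : p ∈ G) (hq : q ∈ G.erase p)
      (h1 : 1 ≤ p) (h2 : 1 ≤ q) : MoveC G (takeOne (takeOne G p) q)

mutual
  /-- P-positions of Version C under normal play: every move leads to an N-position
  (in particular the empty position is a P-position).  Since every move strictly
  decreases the total number of tokens, this inductive definition agrees with the
  usual recursive definition of outcome classes. -/
  inductive PPosC : Multiset ℕ → Prop
    | mk : ∀ {G : Multiset ℕ}, (∀ H, MoveC G H → NPosC H) → PPosC G
  /-- N-positions of Version C under normal play: some move leads to a P-position. -/
  inductive NPosC : Multiset ℕ → Prop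
    | mk : ∀ {G H : Multiset ℕ}, MoveC G H → PPosC H → NPosC G
end

/-- The position obtained from a multiset of pile sizes by discarding empty piles. -/
def nonzeroPiles (s : Multiset ℕ) : Multiset ℕ := s.filter (· ≠ 0)

theorem nonzeroPiles_cons {p : ℕ} (hp : p ≠ 0) (t : Multiset ℕ) :
    nonzeroPiles (p ::ₘ t) = p ::ₘ nonzeroPiles t :=
  Multiset.filter_cons_of_pos (p := (· ≠ 0)) t hp

theorem takeOne_nonzeroPiles_cons {p : ℕ} (hp : 1 ≤ p) (t : Multiset ℕ) :
    takeOne (nonzeroPiles (p ::ₘ t)) p = nonzeroPiles ((p - 1) ::ₘ t) := by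
  have h0 : p ≠ 0 := by omega
  by_cases h1 : p = 1
  · subst h1
    simp [takeOne, nonzeroPiles]
  · have h2 : p - 1 ≠ 0 := by omega
    rw [takeOne, nonzeroPiles_cons h0, nonzeroPiles_cons h2, Multiset.erase_cons_head,
      if_neg h1, add_comm, Multiset.singleton_add]

theorem takeOne_takeOne_nonzeroPiles {p q : ℕ} (hp : 1 ≤ p) (hq : 1 ≤ q) (t : Multiset ℕ) :
    takeOne (takeOne (nonzeroPiles (p ::ₘ q ::ₘ t)) p) q =
      nonzeroPiles ((p - 1) ::ₘ (q - 1) ::ₘ t) := by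
  rw [takeOne_nonzeroPiles_cons hp, Multiset.cons_swap, takeOne_nonzeroPiles_cons hq,
    Multiset.cons_swap]

theorem moveC_nonzeroPiles_one {p : ℕ} (hp : 1 ≤ p) (t : Multiset ℕ) :
    MoveC (nonzeroPiles (p ::ₘ t)) (nonzeroPiles ((p - 1) ::ₘ t)) := by
  rw [← takeOne_nonzeroPiles_cons hp]
  exact .one (by simp [nonzeroPiles]; omega) hp

theorem moveC_nonzeroPiles_two {p q : ℕ} (hp : 1 ≤ p) (hq : 1 ≤ q) (t : Multiset ℕ) :
    MoveC (nonzeroPiles (p ::ₘ q ::ₘ t)) (nonzeroPiles ((p - 1) ::ₘ (q - 1) ::ₘ t)) := by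
  have hp0 : p ≠ 0 := by omega
  have hq0 : q ≠ 0 := by omega
  rw [← takeOne_takeOne_nonzeroPiles hp hq]
  exact .two (by simp [nonzeroPiles, hp0]) (by simp [nonzeroPiles, hp0, hq0]) hp hq

theorem MoveC.exists_of_nonzeroPiles {s H : Multiset ℕ} (h : MoveC (nonzeroPiles s) H) :
    (∃ p t, 1 ≤ p ∧ s = p ::ₘ t ∧ H = nonzeroPiles ((p - 1) ::ₘ t)) ∨
      ∃ p q t, 1 ≤ p ∧ 1 ≤ q ∧ s = p ::ₘ q ::ₘ t ∧
        H = nonzeroPiles ((p - 1) ::ₘ (q - 1) ::ₘ t) := by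
  cases h with
  | @one p hp h1 =>
    obtain ⟨t, rfl⟩ := Multiset.exists_cons_of_mem (Multiset.mem_of_mem_filter hp)
    exact .inl ⟨p, t, h1, rfl, takeOne_nonzeroPiles_cons h1 t⟩
  | @two p q hp hq h1 h2 =>
    obtain ⟨t, rfl⟩ := Multiset.exists_cons_of_mem (Multiset.mem_of_mem_filter hp)
    have h0 : p ≠ 0 := by omega
    rw [nonzeroPiles_cons h0, Multiset.erase_cons_head] at hq
    obtain ⟨u, rfl⟩ := Multiset.exists_cons_of_mem (Multiset.mem_of_mem_filter hq)
    exact .inr ⟨p, q, u, h1, h2, rfl, takeOne_takeOne_nonzeroPiles h1 h2 u⟩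

theorem PPosC.not_nPosC {G : Multiset ℕ} (h : PPosC G) : ¬ NPosC G :=
  PPosC.rec (motive_1 := fun G _ => ¬ NPosC G) (motive_2 := fun G _ => ¬ PPosC G)
    (fun _ ih hN => by
      obtain ⟨hm, hP⟩ := hN
      exact ih _ hm hP)
    (fun hm _ ih hP => by
      obtain ⟨hP⟩ := hP
      exact ih (hP _ hm)) h

/-- All members of the multiset have the same parity. -/
def SameParity (s : Multiset ℕ) : Prop := ∀ x ∈ s, ∀ y ∈ s, x % 2 = y % 2

theorem sameParity_triple {a b c : ℕ} :
    SameParity (a ::ₘ b ::ₘ {c}) ↔ a % 2 = b % 2 ∧ b % 2 = c % 2 := by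
  simp only [SameParity, Multiset.mem_cons, Multiset.mem_singleton, forall_eq_or_imp, forall_eq,
    true_and, and_true]
  constructor
  · rintro ⟨⟨h1, -⟩, ⟨-, h2⟩, -⟩
    exact ⟨h1, h2⟩
  · rintro ⟨h1, h2⟩
    simp [h1, h2]

/-- Up to reordering, a triple of mixed parity starts with its odd members. -/
theorem exists_triple_of_not_sameParity {s : Multiset ℕ} (hs : s.card = 3)
    (h : ¬ SameParity s) :
    ∃ p q r, s = p ::ₘ q ::ₘ {r} ∧ p % 2 = 1 ∧ r % 2 = 0 := by
  obtain ⟨p, hp, hp1⟩ : ∃ p ∈ s, p % 2 = 1 := by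
    by_contra! hc
    exact h fun x hx y hy => by have := hc x hx; have := hc y hy; omega
  obtain ⟨r, hr, hr0⟩ : ∃ r ∈ s, r % 2 = 0 := by
    by_contra! hc
    exact h fun x hx y hy => by have := hc x hx; have := hc y hy; omega
  obtain ⟨t, rfl⟩ := Multiset.exists_cons_of_mem hp
  have hrt : r ∈ t := (Multiset.mem_cons.1 hr).resolve_left (by rintro rfl; omega)
  obtain ⟨u, rfl⟩ := Multiset.exists_cons_of_mem hrt
  obtain ⟨q, rfl⟩ := Multiset.card_eq_one.1 (show u.card = 1 by simpa using hs)
  exact ⟨p, q, r, by rw [← Multiset.cons_zero, ← Multiset.cons_zero, Multiset.cons_swap r q],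
    hp1, hr0⟩

theorem pPosC_and_nPosC_of_card_eq_three (n : ℕ) : ∀ s : Multiset ℕ, s.sum = n → s.card = 3 →
    (SameParity s → PPosC (nonzeroPiles s)) ∧ (¬ SameParity s → NPosC (nonzeroPiles s)) := by
  induction n using Nat.strong_induction_on with
  | _ n ih =>
  intro s hn hs
  constructor
  · intro h
    refine .mk fun H hH => ?_
    obtain ⟨p, t, hp, rfl, rfl⟩ | ⟨p, q, t, hp, hq, rfl, rfl⟩ := hH.exists_of_nonzeroPiles
    · obtain ⟨x, y, rfl⟩ := Multiset.card_eq_two.1 (show t.card = 2 by simpa using hs)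
      simp only [Multiset.insert_eq_cons] at h hn ⊢
      refine (ih _ ?_ ((p - 1) ::ₘ x ::ₘ {y}) rfl (by simp)).2 ?_
      · simp only [Multiset.sum_cons, Multiset.sum_singleton] at hn ⊢
        omega
      · rw [sameParity_triple] at h ⊢
        omega
    · obtain ⟨x, rfl⟩ := Multiset.card_eq_one.1 (show t.card = 1 by simpa using hs)
      refine (ih _ ?_ ((p - 1) ::ₘ (q - 1) ::ₘ {x}) rfl (by simp)).2 ?_
      · simp only [Multiset.sum_cons, Multiset.sum_singleton] at hn ⊢
        omega
      · rw [sameParity_triple] at h ⊢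
        omega
  · intro h
    obtain ⟨p, q, r, rfl, hp, hr⟩ := exists_triple_of_not_sameParity hs h
    obtain hq | hq := Nat.mod_two_eq_zero_or_one q
    · refine .mk (moveC_nonzeroPiles_one (by omega) _)
        ((ih _ ?_ ((p - 1) ::ₘ q ::ₘ {r}) rfl (by simp)).1 ?_)
      · simp only [Multiset.sum_cons, Multiset.sum_singleton] at hn ⊢
        omega
      · rw [sameParity_triple]
        omega
    · refine .mk (moveC_nonzeroPiles_two (by omega) (by omega) _)
        ((ih _ ?_ ((p - 1) ::ₘ (q - 1) ::ₘ {r}) rfl (by simp)).1 ?_)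
      · simp only [Multiset.sum_cons, Multiset.sum_singleton] at hn ⊢
        omega
      · rw [sameParity_triple]
        omega

theorem pPosC_nonzeroPiles_iff {s : Multiset ℕ} (hs : s.card = 3) :
    PPosC (nonzeroPiles s) ↔ SameParity s := by
  obtain ⟨hP, hN⟩ := pPosC_and_nPosC_of_card_eq_three _ s rfl hs
  exact ⟨fun h => by_contra fun hc => h.not_nPosC (hN hc), hP⟩

/-- In Version C, a three-pile position is a P-position iff all three piles are even
or all three piles are odd. -/
theorem versionC_three_piles (a b c : ℕ) (ha : 1 ≤ a) (hb : 1 ≤ b) (hc : 1 ≤ c) :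
    PPosC {a, b, c} ↔
      (Even a ∧ Even b ∧ Even c) ∨ (Odd a ∧ Odd b ∧ Odd c) := by
  have h : nonzeroPiles {a, b, c} = {a, b, c} := by
    rw [nonzeroPiles, Multiset.filter_eq_self]
    simp only [Multiset.insert_eq_cons, Multiset.mem_cons, Multiset.mem_singleton,
      forall_eq_or_imp, forall_eq]
    omega
  rw [← h, pPosC_nonzeroPiles_iff (by simp), Multiset.insert_eq_cons, Multiset.insert_eq_cons,
    sameParity_triple]
  simp only [Nat.even_iff, Nat.odd_iff]
  omega
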